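/- arXiv:1109.1459 — 3 statements merged into one kernel-verified Lean document; each statement's English description precedes it below -/
import Mathlib

section
/- Let k be an even natural number with k ≥ 2, and set ζ = (1 + i/k)², where i is the imaginary unit in ℂ. Then Re(ζ^k) < 0 and Im(ζ^k) > 0. -/
/-- Polar form of `1 + x i`, with argument `arctan x`. -/
lemma one_add_mul_I_eq_polar (x : ℝ) :
    (1 + x * Complex.I : ℂ) =
      (√(1 + x ^ 2) : ℝ) * (Complex.cos (Real.arctan x) + Complex.sin (Real.arctan x) * Complex.I) := by
  have hs : √(1 + x ^ 2) ≠ 0 := by positivity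
  rw [← Complex.ofReal_cos, ← Complex.ofReal_sin, Real.cos_arctan, Real.sin_arctan]
  apply Complex.ext
  · simp [hs]
  · simp
    field_simp

lemma arctan_lt_self {x : ℝ} (hx : 0 < x) : Real.arctan x < x := by
  simpa only [Real.tan_arctan] using
    Real.lt_tan (Real.arctan_pos.2 hx) (Real.arctan_lt_pi_div_two x)

lemma div_sqrt_one_add_sq_lt_arctan {x : ℝ} (hx : 0 < x) :
    x / √(1 + x ^ 2) < Real.arctan x := by
  simpa only [Real.sin_arctan] using Real.sin_lt (Real.arctan_pos.2 hx)

lemma pi_div_four_mul_lt_arctan {x : ℝ} (hx : 0 < x) (hx' : x ≤ 1 / 2) :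
    Real.pi / 4 * x < Real.arctan x := by
  refine lt_trans ?_ (div_sqrt_one_add_sq_lt_arctan hx)
  have hs : √(1 + x ^ 2) ≤ 1.12 := Real.sqrt_le_iff.2 ⟨by norm_num, by nlinarith⟩
  have hpi : Real.pi / 4 * √(1 + x ^ 2) < 1 := by
    nlinarith [Real.pi_lt_d2, Real.pi_pos]
  rw [lt_div_iff₀ (by positivity)]
  nlinarith

theorem estermann_lemma (k : ℕ) (hk : 2 ≤ k) (hke : Even k)
    (ζ : ℂ) (hζ : ζ = (1 + Complex.I / k) ^ 2) :
    (ζ ^ k).re < 0 ∧ 0 < (ζ ^ k).im := by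
  have hk2 : (2 : ℝ) ≤ k := by exact_mod_cast hk
  set x : ℝ := (k : ℝ)⁻¹ with hx
  have hkx : (k : ℝ) * x = 1 := mul_inv_cancel₀ (by positivity)
  have hx0 : 0 < x := by positivity
  have hx2 : x ≤ 1 / 2 := by nlinarith
  set r : ℝ := √(1 + x ^ 2) ^ (2 * k)
  set φ : ℝ := (2 * k : ℕ) * Real.arctan x with hφ
  have hr : 0 < r := by positivity
  have hpow : ζ ^ k = (r : ℂ) * ((Real.cos φ : ℂ) + (Real.sin φ : ℂ) * Complex.I) := by
    have hbase : (1 + Complex.I / k : ℂ) = 1 + x * Complex.I := by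
      rw [hx]; push_cast; ring
    rw [hζ, ← pow_mul, hbase, one_add_mul_I_eq_polar, mul_pow,
      Complex.cos_add_sin_mul_I_pow, Complex.ofReal_cos, Complex.ofReal_sin, hφ]
    push_cast [r]
    rfl
  have hlow : Real.pi / 2 < φ := by
    have := pi_div_four_mul_lt_arctan hx0 hx2
    rw [hφ]; push_cast
    calc Real.pi / 2 = 2 * k * (Real.pi / 4 * x) := by linear_combination -Real.pi / 2 * hkx
      _ < _ := by gcongr
  have hupp : φ < 2 := by
    have := arctan_lt_self hx0
    rw [hφ]; push_cast
    calc 2 * k * Real.arctan x < 2 * k * x := by gcongr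
      _ = 2 := by linear_combination 2 * hkx
  have hpi := Real.pi_gt_three
  have hcos : Real.cos φ < 0 :=
    Real.cos_neg_of_pi_div_two_lt_of_lt hlow (by linarith)
  have hsin : 0 < Real.sin φ := Real.sin_pos_of_pos_of_lt_pi (by linarith) (by linarith)
  rw [hpow, Complex.re_ofReal_mul, Complex.im_ofReal_mul]
  simp only [Complex.add_re, Complex.add_im, Complex.re_ofReal_mul, Complex.im_ofReal_mul,
    Complex.ofReal_re, Complex.ofReal_im, Complex.I_re, Complex.I_im, mul_zero, mul_one,
    add_zero, zero_add]
  exact ⟨mul_neg_of_pos_of_neg hr hcos, mul_pos hr hsin⟩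
end

section
/- Let k be an even natural number with k ≥ 2 and set ζ = (1 + i/k)². Then Re(ζ^k) < 0. -/
/-- The real part of `(1 + i x) ^ n`, in polar form. -/
theorem re_one_add_mul_I_pow (x : ℝ) (n : ℕ) :
    ((1 + x * Complex.I) ^ n).re =
      (Real.cos (Real.arctan x))⁻¹ ^ n * Real.cos (n * Real.arctan x) := by
  have hcos : Real.cos (Real.arctan x) ≠ 0 := (Real.cos_arctan_pos x).ne'
  have hsin : x * Real.cos (Real.arctan x) = Real.sin (Real.arctan x) := by
    conv_lhs => rw [← Real.tan_arctan x]
    rw [Real.arctan_tan (Real.neg_pi_div_two_lt_arctan x) (Real.arctan_lt_pi_div_two x)]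
    exact Real.tan_mul_cos hcos
  have hpolar : (1 + x * Complex.I : ℂ) = ((Real.cos (Real.arctan x))⁻¹ : ℝ) *
      (Complex.cos (Real.arctan x : ℝ) + Complex.sin (Real.arctan x : ℝ) * Complex.I) := by
    rw [← Complex.ofReal_cos, ← Complex.ofReal_sin, ← hsin]
    have hcosC : (Real.cos (Real.arctan x) : ℂ) ≠ 0 := Complex.ofReal_ne_zero.mpr hcos
    push_cast [-Complex.ofReal_cos, -Complex.ofReal_arctan]
    field_simp
  rw [hpolar, mul_pow, Complex.cos_add_sin_mul_I_pow, ← Complex.ofReal_pow,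
    Complex.re_ofReal_mul, ← Complex.ofReal_natCast, ← Complex.ofReal_mul,
    ← Complex.ofReal_cos, ← Complex.ofReal_sin]
  simp [-Complex.ofReal_cos, -Complex.ofReal_sin, -Complex.ofReal_arctan]

theorem arctan_le_self_of_nonneg {x : ℝ} (hx : 0 ≤ x) : Real.arctan x ≤ x := by
  simpa using Real.le_tan (Real.arctan_nonneg.mpr hx) (Real.arctan_lt_pi_div_two x)

theorem div_one_add_sq_le_arctan {x : ℝ} (hx : 0 ≤ x) : x / (1 + x ^ 2) ≤ Real.arctan x := by
  have hsin := Real.sin_le (mul_nonneg zero_le_two (Real.arctan_nonneg.mpr hx))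
  have hsq : √(1 + x ^ 2) * √(1 + x ^ 2) = 1 + x ^ 2 := Real.mul_self_sqrt (by positivity)
  rw [Real.sin_two_mul, Real.sin_arctan, Real.cos_arctan, mul_assoc, div_mul_div_comm, hsq,
    mul_one] at hsin
  linarith

theorem estermann_re (k : ℕ) (hk : 2 ≤ k) (hke : Even k)
    (ζ : ℂ) (hζ : ζ = (1 + Complex.I / k) ^ 2) :
    (ζ ^ k).re < 0 := by
  have hkR : (2 : ℝ) ≤ k := by exact_mod_cast hk
  have hx : (0 : ℝ) ≤ (k : ℝ)⁻¹ := by positivity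
  have hbase : (1 + Complex.I / k : ℂ) = 1 + ((k : ℝ)⁻¹ : ℝ) * Complex.I := by
    push_cast
    ring
  rw [hζ, ← pow_mul, hbase, re_one_add_mul_I_pow]
  refine mul_neg_of_pos_of_neg (pow_pos (inv_pos.mpr (Real.cos_arctan_pos _)) _) ?_
  have hupper : (k : ℝ) * Real.arctan (k : ℝ)⁻¹ ≤ 1 := by
    calc (k : ℝ) * Real.arctan (k : ℝ)⁻¹ ≤ k * (k : ℝ)⁻¹ := by
          gcongr
          exact arctan_le_self_of_nonneg hx
      _ = 1 := mul_inv_cancel₀ (by positivity)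
  have hlower : (4 / 5 : ℝ) ≤ k * Real.arctan (k : ℝ)⁻¹ := by
    calc (4 / 5 : ℝ) ≤ k * ((k : ℝ)⁻¹ / (1 + (k : ℝ)⁻¹ ^ 2)) := by
          have : (0 : ℝ) < k := by positivity
          field_simp
          nlinarith
      _ ≤ k * Real.arctan (k : ℝ)⁻¹ := by
          gcongr
          exact div_one_add_sq_le_arctan hx
  push_cast
  apply Real.cos_neg_of_pi_div_two_lt_of_lt
  · linarith [Real.pi_lt_d2]
  · linarith [Real.pi_gt_three]
end

section
/- Let k be an even natural number with k ≥ 2 and set ζ = (1 + i/k)². Then Im(ζ^k) > 0. -/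
/-- If `0 < n * x ≤ π`, then `(1 + x * I) ^ n` lies in the open upper half plane: its argument is
`n * arctan x`, which is strictly between `0` and `n * x`. -/
theorem Complex.im_one_add_mul_I_pow_pos {x : ℝ} {n : ℕ} (hx : 0 < x) (hn : 0 < n)
    (hnx : n * x ≤ Real.pi) : 0 < ((1 + x * Complex.I) ^ n).im := by
  set θ := Real.arctan x with hθ
  have hn' : (0 : ℝ) < n := by exact_mod_cast hn
  have hθ0 : 0 < θ := Real.arctan_pos.2 hx
  have hθx : θ < x := by
    simpa [hθ, Real.tan_arctan] using Real.lt_tan hθ0 (Real.arctan_lt_pi_div_two x)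
  have hcos : 0 < Real.cos θ := Real.cos_arctan_pos x
  have hsin : Real.sin θ = x * Real.cos θ := by
    rw [← Real.tan_mul_cos hcos.ne', hθ, Real.tan_arctan]
  have hpolar : ((Real.cos θ : ℝ) : ℂ) * (1 + x * Complex.I)
      = Complex.cos θ + Complex.sin θ * Complex.I := by
    rw [← Complex.ofReal_cos, ← Complex.ofReal_sin, hsin]
    push_cast
    ring
  have hpow : Real.cos θ ^ n * ((1 + x * Complex.I) ^ n).im = Real.sin (n * θ) := by
    have h := congrArg (fun z : ℂ => (z ^ n).im) hpolar
    simp only [mul_pow, Complex.cos_add_sin_mul_I_pow] at h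
    rw [← Complex.ofReal_pow, Complex.im_ofReal_mul] at h
    rw [h]
    have hcast : (n : ℂ) * θ = ((n * θ : ℝ) : ℂ) := by push_cast; rfl
    rw [hcast, ← Complex.ofReal_cos, ← Complex.ofReal_sin, Complex.add_im,
      Complex.ofReal_im, Complex.im_ofReal_mul, Complex.I_im, zero_add, mul_one]
  have hsin_pos : 0 < Real.sin (n * θ) :=
    Real.sin_pos_of_pos_of_lt_pi (by positivity)
      ((mul_lt_mul_of_pos_left hθx hn').trans_le hnx)
  rw [← hpow] at hsin_pos
  exact pos_of_mul_pos_right hsin_pos (by positivity)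

theorem estermann_im (k : ℕ) (hk : 2 ≤ k) (hke : Even k)
    (ζ : ℂ) (hζ : ζ = (1 + Complex.I / k) ^ 2) :
    0 < (ζ ^ k).im := by
  have hk0 : (0 : ℝ) < k := by exact_mod_cast (by omega : 0 < k)
  have hbase : 1 + Complex.I / k = 1 + ((1 / k : ℝ) : ℂ) * Complex.I := by
    push_cast
    ring
  rw [hζ, ← pow_mul, hbase]
  refine Complex.im_one_add_mul_I_pow_pos (by positivity) (by omega) ?_
  have htwo : ((2 * k : ℕ) : ℝ) * (1 / k) = 2 := by
    push_cast
    field_simp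
  rw [htwo]
  exact Real.two_le_pi
end
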